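/- arXiv:1701.03986 — 2 statements merged into one kernel-verified Lean document; each statement's English description precedes it below -/
import Mathlib

section
/- Let m ≥ 5 be an odd integer, n = (4^m − 1)/3, and let δ be an integer with 2 ≤ δ ≤ 2^m. Define J⁺(δ) = ∪_{i=1}^{δ−1} C_i and J⁻(δ) = ∪_{i=1}^{δ−1} C_{−2i}, where C_s denotes the 4-cyclotomic coset of s modulo n. Then |J⁺(δ) ∩ J⁻(δ)| = 0 if 2 ≤ δ ≤ (2^{m+1} − 1)/3; |J⁺(δ) ∩ J⁻(δ)| = 2m if (2^{m+1} − 1)/3 + 1 ≤ δ ≤ 2^m − 1; and |J⁺(δ) ∩ J⁻(δ)| = 3m if δ = 2^m. -/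
open Polynomial

noncomputable section

/-- The cyclic shift of a vector: `(c₀,…,c_{n−1}) ↦ (c_{n−1},c₀,…,c_{n−2})`. -/
def cyclicShift {F : Type*} {n : ℕ} (c : Fin n → F) : Fin n → F :=
  fun i => c ⟨(i.val + (n - 1)) % n, Nat.mod_lt _ i.pos⟩

/-- A linear code (submodule of `F^n`) is cyclic if it is stable under the cyclic shift. -/
def IsCyclicCode {F : Type*} [Field F] {n : ℕ} (C : Submodule F (Fin n → F)) : Prop :=
  ∀ c ∈ C, cyclicShift c ∈ C

/-- The Hermitian dual `C^⊥H = {b : ∑ i, b i * (c i)^q = 0 for all c ∈ C}`. -/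
def hermDualSet {F : Type*} [Field F] (q : ℕ) {n : ℕ} (C : Set (Fin n → F)) :
    Set (Fin n → F) :=
  {b | ∀ c ∈ C, ∑ i, b i * (c i) ^ q = 0}

/-- A code is Hermitian LCD if `C ∩ C^⊥H = {0}`. -/
def IsHermitianLCD {F : Type*} [Field F] (q : ℕ) {n : ℕ} (C : Set (Fin n → F)) : Prop :=
  C ∩ hermDualSet q C = {0}

/-- The polynomial `c₀ + c₁ x + ⋯ + c_{n−1} x^{n−1}` associated with a vector. -/
def polyOfVec {F : Type*} [Field F] {n : ℕ} (c : Fin n → F) : Polynomial F :=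
  ∑ i : Fin n, Polynomial.C (c i) * Polynomial.X ^ (i : ℕ)

/-- The cyclic code of length `n` with generator polynomial `g` (for `g ∣ xⁿ − 1`):
vectors whose associated polynomial (of degree `< n`) is divisible by `g`. -/
def cyclicCodeOf {F : Type*} [Field F] (n : ℕ) (g : Polynomial F) :
    Submodule F (Fin n → F) where
  carrier := {c | g ∣ polyOfVec c}
  add_mem' := by
    intro a b ha hb
    have h : polyOfVec (a + b) = polyOfVec a + polyOfVec b := by
      simp [polyOfVec, add_mul, Finset.sum_add_distrib]
    simpa [Set.mem_setOf_eq, h] using dvd_add ha hb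
  zero_mem' := by simp [polyOfVec]
  smul_mem' := by
    intro r c hc
    have h : polyOfVec (r • c) = Polynomial.C r * polyOfVec c := by
      simp [polyOfVec, Finset.mul_sum, mul_assoc]
    simpa [Set.mem_setOf_eq, h] using hc.mul_left (Polynomial.C r)

/-- `f̄`: the polynomial obtained by raising every coefficient of `f` to the `q`-th power. -/
def conjPoly {F : Type*} [Field F] (q : ℕ) (f : Polynomial F) : Polynomial F :=
  f.sum fun i a => Polynomial.C (a ^ q) * Polynomial.X ^ i

/-- The reciprocal polynomial `f*(x) = f₀⁻¹ xᵗ f(1/x)`. -/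
def recipPoly {F : Type*} [Field F] (f : Polynomial F) : Polynomial F :=
  Polynomial.C (f.coeff 0)⁻¹ * f.reverse

/-- The `Q`-cyclotomic coset of `s` modulo `n`, as a subset of `{0,…,n−1} ⊆ ℕ`
(`s` is taken as an integer so that negative indices are allowed). -/
def cycCoset (Q n : ℕ) (s : ℤ) : Set ℕ :=
  {x | x < n ∧ ∃ j : ℕ, (x : ℤ) ≡ s * (Q : ℤ) ^ j [ZMOD n]}

end

/-- With `4 ^ h = 3 * r + 1`, the number `(2 * r + 1) * (6 * r + 1)` is `(4 ^ (2 * h + 1) - 1) / 3`. -/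
theorem pow_two_mul_add_one_modEq_one {h r : ℕ} (hr : 4 ^ h = 3 * r + 1) :
    4 ^ (2 * h + 1) ≡ 1 [MOD (2 * r + 1) * (6 * r + 1)] := by
  have e : 4 ^ (2 * h + 1) = 1 + (2 * r + 1) * (6 * r + 1) * 3 := by
    rw [pow_succ, mul_comm 2 h, pow_mul, hr]; ring
  rw [e, Nat.ModEq, Nat.add_mul_mod_self_left]

theorem coprime_four_pow_modulus (r i : ℕ) :
    Nat.Coprime ((2 * r + 1) * (6 * r + 1)) (4 ^ i) := by
  have h : Nat.Coprime ((2 * r + 1) * (6 * r + 1)) 2 := by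
    rw [Nat.coprime_two_right]
    exact Odd.mul ⟨r, rfl⟩ ⟨3 * r, by ring⟩
  exact Nat.Coprime.pow_right _ (show Nat.Coprime _ (2 * 2) from h.mul_right h)

theorem four_mul_pow_le {h r k : ℕ} (hr : 4 ^ h = 3 * r + 1) (hk : k < h) :
    4 * 4 ^ k ≤ 3 * r + 1 := by
  rw [← hr, ← pow_succ']
  exact Nat.pow_le_pow_right (by norm_num) hk

theorem not_dvd_add_two_mul {r a b x : ℕ} (h5 : 5 ≤ r) (hx : 4 * x ≤ 3 * r + 1)
    (ha : a ≤ 6 * r + 1) (hb1 : 1 ≤ b) (hb : b ≤ 6 * r + 1) :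
    ¬ (2 * r + 1) * (6 * r + 1) ∣ b + 2 * a * x := by
  intro hd
  have h1 := Nat.le_of_dvd (by omega) hd
  have h2 : a * (4 * x) ≤ (6 * r + 1) * (3 * r + 1) := Nat.mul_le_mul ha hx
  nlinarith

theorem eq_of_dvd_add_mul {r a b : ℕ} (ha : a ≤ 6 * r + 1) (hb1 : 1 ≤ b) (hb : b ≤ 6 * r + 1)
    (hd : (2 * r + 1) * (6 * r + 1) ∣ b + 2 * a * (3 * r + 1)) :
    (a = 2 * r ∧ b = 4 * r + 1) ∨ (a = 4 * r + 1 ∧ b = 2 * r) ∨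
      (a = 6 * r + 1 ∧ b = 6 * r + 1) := by
  obtain ⟨t, ht⟩ := hd
  have key (a' b' : ℕ) (hb1' : 1 ≤ b') (hb' : b' ≤ 6 * r + 1)
      (e : b + 2 * a * (3 * r + 1) = b' + 2 * a' * (3 * r + 1)) : a = a' ∧ b = b' := by
    have : a = a' := by
      rcases lt_trichotomy a a' with hl | hl | hl
      · nlinarith
      · exact hl
      · nlinarith
    subst this
    exact ⟨rfl, by omega⟩
  have ht3 : t < 4 := by
    by_contra! h4
    have h1 : (2 * r + 1) * (6 * r + 1) * 4 ≤ (2 * r + 1) * (6 * r + 1) * t :=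
      Nat.mul_le_mul_left _ h4
    have h2 : a * (6 * r + 2) ≤ (6 * r + 1) * (6 * r + 2) := Nat.mul_le_mul_right _ ha
    nlinarith
  interval_cases t
  · omega
  · exact Or.inl (key _ _ (by omega) (by omega) (by rw [ht]; ring))
  · rcases Nat.eq_zero_or_pos r with rfl | hpos
    · omega
    · exact Or.inr (Or.inl (key _ _ (by omega) (by omega) (by rw [ht]; ring)))
  · exact Or.inr (Or.inr (key _ _ (by omega) (by omega) (by rw [ht]; ring)))

/-- The pairs `(a, b)` of small representatives for which the coset of `b` is that of `-2 * a`. -/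
theorem exists_dvd_add_two_mul_pow_iff {h r a b : ℕ} (hr : 4 ^ h = 3 * r + 1) (h5 : 5 ≤ r)
    (ha1 : 1 ≤ a) (ha : a ≤ 6 * r + 1) (hb1 : 1 ≤ b) (hb : b ≤ 6 * r + 1) :
    (∃ k, (2 * r + 1) * (6 * r + 1) ∣ b + 2 * a * 4 ^ k) ↔
      (a = 2 * r ∧ b = 4 * r + 1) ∨ (a = 4 * r + 1 ∧ b = 2 * r) ∨
        (a = 6 * r + 1 ∧ b = 6 * r + 1) := by
  have hper := pow_two_mul_add_one_modEq_one hr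
  constructor
  · rintro ⟨k, hk⟩
    have hred : 4 ^ k ≡ 4 ^ (k % (2 * h + 1)) [MOD (2 * r + 1) * (6 * r + 1)] := by
      conv_lhs => rw [← Nat.div_add_mod k (2 * h + 1), pow_add, pow_mul]
      simpa using (hper.pow (k / (2 * h + 1))).mul_right (4 ^ (k % (2 * h + 1)))
    rw [((hred.mul_left (2 * a)).add_left b).dvd_iff dvd_rfl] at hk
    have hlt : k % (2 * h + 1) < 2 * h + 1 := Nat.mod_lt _ (by omega)
    generalize k % (2 * h + 1) = l at hk hlt
    rcases lt_trichotomy l h with hl | rfl | hl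
    · exact absurd hk (not_dvd_add_two_mul h5 (four_mul_pow_le hr hl) ha hb1 hb)
    · rw [hr] at hk
      exact eq_of_dvd_add_mul ha hb1 hb hk
    · refine absurd ?_ (not_dvd_add_two_mul (x := 4 ^ (2 * h - l)) h5
        (four_mul_pow_le hr (by omega)) hb ha1 ha)
      have h1 := hk.mul_left (2 * 4 ^ (2 * h - l))
      have h2 : 2 * 4 ^ (2 * h - l) * (b + 2 * a * 4 ^ l)
          = a * 4 ^ (2 * h + 1) + 2 * b * 4 ^ (2 * h - l) := by
        have : 4 ^ (2 * h + 1) = 4 * (4 ^ (2 * h - l) * 4 ^ l) := by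
          rw [← pow_add, ← pow_succ']; congr 1; omega
        rw [this]; ring
      rw [h2, ((hper.mul_left a).add_right _).dvd_iff dvd_rfl, mul_one] at h1
      exact h1
  · intro hab
    refine ⟨h, ?_⟩
    rw [hr]
    rcases hab with ⟨rfl, rfl⟩ | ⟨rfl, rfl⟩ | ⟨rfl, rfl⟩
    · exact ⟨1, by ring⟩
    · exact ⟨2, by ring⟩
    · exact ⟨3, by ring⟩

theorem eq_zero_and_eq_of_mul_pow_modEq_of_le {h r b b' d : ℕ} (hr : 4 ^ h = 3 * r + 1)
    (h5 : 5 ≤ r) (hb : b = 2 * r ∨ b = 4 * r + 1 ∨ b = 6 * r + 1)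
    (hb' : b' = 2 * r ∨ b' = 4 * r + 1 ∨ b' = 6 * r + 1) (hd : d ≤ h)
    (hmod : b' ≡ b * 4 ^ d [MOD (2 * r + 1) * (6 * r + 1)]) : d = 0 ∧ b = b' := by
  have hble : b ≤ 6 * r + 1 := by omega
  have hble' : b' ≤ 6 * r + 1 := by omega
  have hn : 6 * r + 1 < (2 * r + 1) * (6 * r + 1) := by nlinarith
  rcases Nat.eq_zero_or_pos d with rfl | hpos
  · rw [pow_zero, mul_one] at hmod
    exact ⟨rfl, (hmod.eq_of_lt_of_lt (by omega) (by omega)).symm⟩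
  exfalso
  have h4 : 4 ≤ 4 ^ d := Nat.le_self_pow (by omega) 4
  have hlt : b' < b * 4 ^ d := by
    have h1 := Nat.mul_le_mul_left b h4
    have h2 : 2 * r ≤ b := by omega
    linarith
  obtain ⟨t, ht⟩ := (Nat.modEq_iff_dvd' hlt.le).mp hmod
  have ht : b * 4 ^ d = b' + (2 * r + 1) * (6 * r + 1) * t := by omega
  have ht0 : 1 ≤ t := by
    rcases Nat.eq_zero_or_pos t with rfl | h
    · omega
    · exact h
  have ht1 : (2 * r + 1) * (6 * r + 1) * 1 ≤ (2 * r + 1) * (6 * r + 1) * t :=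
    Nat.mul_le_mul_left _ ht0
  rcases hd.lt_or_eq with hlt' | rfl
  · have h1 := Nat.mul_le_mul hble (four_mul_pow_le hr hlt')
    nlinarith
  · rw [hr] at ht
    rcases hb with rfl | rfl | rfl
    · nlinarith
    · nlinarith [show 2 * r ≤ b' by omega]
    · rcases ht0.eq_or_lt with rfl | h2
      · nlinarith
      · have ht2 : (2 * r + 1) * (6 * r + 1) * 2 ≤ (2 * r + 1) * (6 * r + 1) * t :=
          Nat.mul_le_mul_left _ h2
        nlinarith

theorem eq_zero_and_eq_of_mul_pow_modEq {h r b b' d : ℕ} (hr : 4 ^ h = 3 * r + 1)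
    (h5 : 5 ≤ r) (hb : b = 2 * r ∨ b = 4 * r + 1 ∨ b = 6 * r + 1)
    (hb' : b' = 2 * r ∨ b' = 4 * r + 1 ∨ b' = 6 * r + 1) (hd : d < 2 * h + 1)
    (hmod : b' ≡ b * 4 ^ d [MOD (2 * r + 1) * (6 * r + 1)]) : d = 0 ∧ b = b' := by
  rcases le_or_gt d h with hle | hgt
  · exact eq_zero_and_eq_of_mul_pow_modEq_of_le hr h5 hb hb' hle hmod
  · have h1 := hmod.mul_right (4 ^ (2 * h + 1 - d))
    rw [mul_assoc, ← pow_add, Nat.add_sub_cancel' hd.le] at h1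
    have h2 := h1.trans ((pow_two_mul_add_one_modEq_one hr).mul_left b)
    rw [mul_one] at h2
    have := eq_zero_and_eq_of_mul_pow_modEq_of_le hr h5 hb' hb
      (show 2 * h + 1 - d ≤ h by omega) h2.symm
    omega

theorem card_image_mul_pow_mod {h r : ℕ} (hr : 4 ^ h = 3 * r + 1) (h5 : 5 ≤ r) (S : Finset ℕ)
    (hS : ∀ b ∈ S, b = 2 * r ∨ b = 4 * r + 1 ∨ b = 6 * r + 1) :
    ((S ×ˢ Finset.range (2 * h + 1)).image
      fun p => p.1 * 4 ^ p.2 % ((2 * r + 1) * (6 * r + 1))).card = S.card * (2 * h + 1) := by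
  rw [Finset.card_image_of_injOn, Finset.card_product, Finset.card_range]
  have main (b b' i j : ℕ) (hb : b ∈ S) (hb' : b' ∈ S) (hi : i < 2 * h + 1) (hij : j ≤ i)
      (e : b * 4 ^ i ≡ b' * 4 ^ j [MOD (2 * r + 1) * (6 * r + 1)]) : b = b' ∧ i = j := by
    rw [← Nat.sub_add_cancel hij, pow_add, ← mul_assoc] at e
    have e' := Nat.ModEq.cancel_right_of_coprime (coprime_four_pow_modulus r j) e
    have := eq_zero_and_eq_of_mul_pow_modEq hr h5 (hS b hb) (hS b' hb')
      (show i - j < 2 * h + 1 by omega) e'.symm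
    omega
  rintro ⟨b, i⟩ hp ⟨b', j⟩ hp' e
  simp only [Finset.coe_product, Set.mem_prod, Finset.mem_coe, Finset.mem_range] at hp hp'
  rcases le_total j i with hij | hij
  · obtain ⟨rfl, rfl⟩ := main b b' i j hp.1 hp'.1 hp.2 hij e
    rfl
  · obtain ⟨rfl, rfl⟩ := main b' b j i hp'.1 hp.1 hp'.2 hij e.symm
    rfl

/-- If `4 ^ m ≡ 1` modulo `n`, the elements shared by `⋃ C_i` and `⋃ C_{-2i}` are those of the
cosets whose index `b` satisfies `n ∣ b + 2 * a * 4 ^ k` for some admissible `a`. -/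
theorem inter_iUnion_cycCoset_eq_image {m n : ℕ} (hm : 0 < m) (hn : 0 < n)
    (hper : 4 ^ m ≡ 1 [MOD n]) (I S : Finset ℕ)
    (hS : ∀ b, b ∈ S ↔ b ∈ I ∧ ∃ a ∈ I, ∃ k, n ∣ b + 2 * a * 4 ^ k) :
    ((⋃ i ∈ I, cycCoset 4 n (i : ℤ)) ∩ (⋃ i ∈ I, cycCoset 4 n (-(2 * (i : ℤ))))) =
      ((S ×ˢ Finset.range m).image fun p => p.1 * 4 ^ p.2 % n : Finset ℕ) := by
  have hred (j : ℕ) : 4 ^ j ≡ 4 ^ (j % m) [MOD n] := by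
    conv_lhs => rw [← Nat.div_add_mod j m, pow_add, pow_mul]
    simpa using (hper.pow (j / m)).mul_right (4 ^ (j % m))
  have hinv (j : ℕ) : 4 ^ (j * (m - 1)) * 4 ^ j ≡ 1 [MOD n] := by
    rw [← pow_add, ← Nat.mul_succ, Nat.succ_eq_add_one, Nat.sub_add_cancel hm, mul_comm, pow_mul]
    simpa using hper.pow j
  simp only [← ZMod.natCast_eq_natCast_iff, Nat.cast_mul, Nat.cast_pow, Nat.cast_ofNat,
    Nat.cast_one] at hinv
  have hS' (b : ℕ) : b ∈ S ↔ b ∈ I ∧ ∃ a ∈ I, ∃ k : ℕ, (b : ZMod n) = -(2 * a) * 4 ^ k := by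
    rw [hS]
    simp only [← ZMod.natCast_eq_zero_iff, Nat.cast_add, Nat.cast_mul, Nat.cast_pow,
      Nat.cast_ofNat, neg_mul, ← eq_neg_iff_add_eq_zero]
  ext x
  simp only [cycCoset, Set.mem_inter_iff, Set.mem_iUnion, Set.mem_ofPred_eq, Finset.coe_image,
    Set.mem_image, Finset.mem_coe, Finset.mem_product, Finset.mem_range, Prod.exists, exists_prop,
    ← ZMod.intCast_eq_intCast_iff, hS']
  push_cast
  constructor
  · rintro ⟨⟨b, hb, hx, j, hj⟩, a, ha, -, k, hk⟩
    refine ⟨b, j % m, ⟨⟨hb, a, ha, k + j * (m - 1), ?_⟩, Nat.mod_lt _ hm⟩, ?_⟩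
    · rw [pow_add, ← mul_assoc, ← hk, hj]
      linear_combination -(b : ZMod n) * hinv j
    · have h1 : (x : ZMod n) = ((b * 4 ^ j : ℕ) : ZMod n) := by rw [hj]; push_cast; rfl
      rw [ZMod.natCast_eq_natCast_iff] at h1
      have h2 := h1.trans ((hred j).mul_left b)
      rw [← Nat.mod_eq_of_lt hx]
      exact h2.symm
  · rintro ⟨b, j, ⟨⟨hb, a, ha, k, hk⟩, -⟩, rfl⟩
    have hlt := Nat.mod_lt (b * 4 ^ j) hn
    refine ⟨⟨b, hb, hlt, j, by simp⟩, a, ha, hlt, k + j, ?_⟩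
    rw [ZMod.natCast_mod, pow_add, ← mul_assoc, ← hk]
    push_cast
    rfl

theorem ncard_inter_iUnion_cycCoset {h r D : ℕ} (hr : 4 ^ h = 3 * r + 1) (h5 : 5 ≤ r)
    (hD : D ≤ 6 * r + 1) (S : Finset ℕ)
    (hS : ∀ b, b ∈ S ↔ ((b = 2 * r ∨ b = 4 * r + 1) ∧ 4 * r + 1 ≤ D) ∨
      (b = 6 * r + 1 ∧ 6 * r + 1 ≤ D)) :
    ((⋃ i ∈ Finset.Icc 1 D, cycCoset 4 ((2 * r + 1) * (6 * r + 1)) (i : ℤ)) ∩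
      (⋃ i ∈ Finset.Icc 1 D, cycCoset 4 ((2 * r + 1) * (6 * r + 1)) (-(2 * (i : ℤ))))).ncard =
      S.card * (2 * h + 1) := by
  rw [inter_iUnion_cycCoset_eq_image (m := 2 * h + 1) (by omega) (by positivity)
    (pow_two_mul_add_one_modEq_one hr) _ S, Set.ncard_coe_finset,
    card_image_mul_pow_mod hr h5 S (fun b hb => by have := (hS b).mp hb; omega)]
  intro b
  simp only [Finset.mem_Icc, hS]
  constructor
  · intro hb
    have hbD : 1 ≤ b ∧ b ≤ D := by omega
    have hw (a : ℕ) (ha1 : 1 ≤ a) (ha : a ≤ D) :=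
      exists_dvd_add_two_mul_pow_iff (a := a) hr h5 ha1 (ha.trans hD) hbD.1 (hbD.2.trans hD)
    refine ⟨hbD, ?_⟩
    rcases hb with ⟨rfl | rfl, hb⟩ | ⟨rfl, hb⟩
    · exact ⟨4 * r + 1, by omega, (hw _ (by omega) (by omega)).mpr (by omega)⟩
    · exact ⟨2 * r, by omega, (hw _ (by omega) (by omega)).mpr (by omega)⟩
    · exact ⟨6 * r + 1, by omega, (hw _ (by omega) (by omega)).mpr (by omega)⟩
  · rintro ⟨⟨hb1, hb⟩, a, ⟨ha1, ha⟩, hk⟩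
    have := (exists_dvd_add_two_mul_pow_iff hr h5 ha1 (ha.trans hD) hb1 (hb.trans hD)).mp hk
    omega

/-- For odd `m ≥ 5`, `n = (4ᵐ − 1)/3`, `2 ≤ δ ≤ 2ᵐ`, the cardinality of
`J⁺(δ) ∩ J⁻(δ)` (with `J⁺(δ) = ∪_{i=1}^{δ−1} C_i`, `J⁻(δ) = ∪_{i=1}^{δ−1} C_{−2i}`). -/
theorem stmt16 {m n δ : ℕ} (hm : 5 ≤ m) (hmodd : m % 2 = 1) (hn : n = (4 ^ m - 1) / 3)
    (hδ1 : 2 ≤ δ) (hδ2 : δ ≤ 2 ^ m) :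
    (δ ≤ (2 ^ (m + 1) - 1) / 3 →
      ((⋃ i ∈ Finset.Icc 1 (δ - 1), cycCoset 4 n (i : ℤ)) ∩
        (⋃ i ∈ Finset.Icc 1 (δ - 1), cycCoset 4 n (-(2 * (i : ℤ))))).ncard = 0) ∧
    ((2 ^ (m + 1) - 1) / 3 + 1 ≤ δ → δ ≤ 2 ^ m - 1 →
      ((⋃ i ∈ Finset.Icc 1 (δ - 1), cycCoset 4 n (i : ℤ)) ∩
        (⋃ i ∈ Finset.Icc 1 (δ - 1), cycCoset 4 n (-(2 * (i : ℤ))))).ncard = 2 * m) ∧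
    (δ = 2 ^ m →
      ((⋃ i ∈ Finset.Icc 1 (δ - 1), cycCoset 4 n (i : ℤ)) ∩
        (⋃ i ∈ Finset.Icc 1 (δ - 1), cycCoset 4 n (-(2 * (i : ℤ))))).ncard = 3 * m) := by
  obtain ⟨h, rfl⟩ : ∃ h, m = 2 * h + 1 := ⟨m / 2, by omega⟩
  obtain ⟨r, hr⟩ : ∃ r, 4 ^ h = 3 * r + 1 := by
    refine ⟨4 ^ h / 3, ?_⟩
    have : 4 ^ h % 3 = 1 := by simp [Nat.pow_mod]
    omega
  have h5 : 5 ≤ r := by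
    have : 4 ^ 2 ≤ 4 ^ h := Nat.pow_le_pow_right (by norm_num) (by omega)
    omega
  have hM : 2 ^ (2 * h + 1) = 6 * r + 2 := by
    rw [pow_succ, pow_mul]; norm_num [hr]; ring
  have hn' : n = (2 * r + 1) * (6 * r + 1) := by
    have e : 4 ^ (2 * h + 1) = (2 * r + 1) * (6 * r + 1) * 3 + 1 := by
      rw [pow_succ, mul_comm 2 h, pow_mul, hr]; ring
    rw [hn, e]; omega
  rw [pow_succ 2 (2 * h + 1)]
  rw [hM] at hδ2 ⊢
  clear hn
  subst hn'
  have hcard := ncard_inter_iUnion_cycCoset (D := δ - 1) hr h5 (by omega)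
  refine ⟨fun h1 => ?_, fun h1 h2 => ?_, fun h1 => ?_⟩
  · rw [hcard ∅ fun b => by simp only [Finset.notMem_empty, false_iff]; omega]
    simp
  · rw [hcard {2 * r, 4 * r + 1} fun b => by
      simp only [Finset.mem_insert, Finset.mem_singleton]; omega, Finset.card_pair (by omega)]
  · rw [hcard {2 * r, 4 * r + 1, 6 * r + 1} fun b => by
      simp only [Finset.mem_insert, Finset.mem_singleton]; omega,
      Finset.card_eq_three.mpr ⟨_, _, _, by omega, by omega, by omega, rfl⟩]
end

section
/- Let m ≥ 5 be an odd integer, n = (4^m − 1)/3, and 2 ≤ δ ≤ 2^m. Let β be a primitive n-th root of unity in an extension of GF(4), m_i(x) the minimal polynomial of β^i over GF(4) (indices modulo n), and let C be the cyclic code of length n over GF(4) with generator polynomial g(x) = (x − 1) · g_{(n,δ,1)}(x) · lcm(m_{n−2(δ−1)}(x), m_{n−2(δ−2)}(x), …, m_{n−2}(x)). Then C is a Hermitian LCD code over GF(4) of length n = (4^m − 1)/3, its minimum distance d satisfies d ≥ δ + 1 + ⌊(δ−1)/2⌋, and its dimension k equals: (4^m − 1)/3 − 2(δ − ⌊(δ−1)/4⌋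 − 1)m − 1, if 2 ≤ δ ≤ (2^{m+1} − 1)/3; (4^m − 1)/3 − 2(δ − ⌊(δ−1)/4⌋ − 2)m − 1, if δ = (2^{m+1} + 2)/3; (4^m − 1)/3 − 2(δ − ⌊(δ−1)/4⌋ − 3)m − 1, if (2^{m+1} + 2)/3 + 1 ≤ δ ≤ (2^{m+1} + 2^{m−1} + 1)/3; (4^m − 1)/3 − 2(δ − ⌊(δ−1)/4⌋ − 4)m − 1, if (2^{m+1} + 2^{m−1} + 1)/3 + 1 ≤ δ ≤ 2^m − 1; (4^m − 1)/3 − 2(δ − ⌊(δ−1)/4⌋)m + 9m − 1, if δ = 2^m. -/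
open Polynomial

/-- Solutions of `2 ^ l * j ≡ i` modulo `(4 ^ m - 1) / 3` with `l` even, where `P = 2 ^ l` and
`t = P * R = 2 ^ m`. -/
lemma even_power_relation {P R t i j c : ℤ} (hPR : t = P * R) (hP : 4 ≤ P) (hP3 : P % 3 = 1)
    (hR : R = 2 ∨ 8 ≤ R) (hi1 : 1 ≤ i) (hi : i < t) (hj1 : 1 ≤ j) (hj : j < t)
    (h : 3 * (P * j - i) = c * (t ^ 2 - 1)) :
    i = P * j ∨ (3 * i = t + 1 ∧ 3 * j = 2 * t + 2) ∨ (3 * j = 2 * t + 5 ∧ 6 * i = 5 * t + 2) := by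
  have ht : 8 ≤ t := by
    rw [hPR]
    nlinarith [hR.elim (fun h => h.ge) (fun h => by linarith : _ → 2 ≤ R)]
  have htt : 8 * t ≤ t ^ 2 := by nlinarith
  have hPj : P ≤ P * j := by nlinarith
  have hPj' : P * j ≤ P * (t - 1) := mul_le_mul_of_nonneg_left (by linarith) (by linarith)
  have hc0 : 0 ≤ c := by
    by_contra! hc
    nlinarith [mul_nonneg (by linarith : 0 ≤ -c - 1) (by linarith : 0 ≤ t ^ 2 - 1)]
  rcases hR with rfl | hR
  · have hc : c ≤ 1 := by
      by_contra! hc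
      nlinarith [mul_nonneg (by linarith : 0 ≤ c - 2) (by linarith : 0 ≤ t ^ 2 - 1)]
    obtain rfl | rfl : c = 0 ∨ c = 1 := by omega
    · left; linarith
    · obtain ⟨u, hu⟩ : ∃ u, u = 3 * j - 4 * P := ⟨_, rfl⟩
      subst hPR
      have hPu : P * u = 3 * i - 1 := by rw [hu]; linarith
      have hu5 : u ≤ 5 := by
        by_contra! h'
        nlinarith
      have hu1 : 1 ≤ u := by
        by_contra! h'
        nlinarith
      obtain rfl | rfl : u = 2 ∨ u = 5 := by omega
      · right; left; constructor <;> linarith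
      · right; right; constructor <;> linarith
  · have hc : c ≤ 0 := by
      by_contra! hc
      nlinarith [mul_nonneg (by linarith : 0 ≤ c - 1) (by linarith : 0 ≤ t ^ 2 - 1),
        mul_nonneg (by linarith : 0 ≤ R - 8) (by linarith : 0 ≤ P),
        mul_nonneg (by nlinarith : 0 ≤ t - 8 * P) (by linarith : 0 ≤ t - 1)]
    left
    obtain rfl : c = 0 := by omega
    linarith

/-- Solutions of `-2 ^ l * j ≡ i` modulo `(4 ^ m - 1) / 3` with `l` odd, where `P = 2 ^ l` and
`t = P * R = 2 ^ m`. -/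
lemma odd_power_relation {P R t i j c : ℤ} (hPR : t = P * R) (hP : 2 ≤ P) (hR : R = 1 ∨ 4 ≤ R)
    (ht : 16 ≤ t) (ht3 : t % 3 = 2) (hi1 : 1 ≤ i) (hi : i < t) (hj1 : 1 ≤ j) (hj : j < t)
    (h : 3 * (P * j + i) = c * (t ^ 2 - 1)) :
    R = 1 ∧ ((i = t - 1 ∧ j = t - 1) ∨ (3 * i = 2 * t - 1 ∧ 3 * j = t - 2) ∨
      (3 * i = t - 2 ∧ 3 * j = 2 * t - 1)) := by
  have htt : 16 * t ≤ t ^ 2 := by nlinarith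
  have hPj : P ≤ P * j := by nlinarith
  have hPj' : P * j ≤ P * (t - 1) := mul_le_mul_of_nonneg_left (by linarith) (by linarith)
  have hc1 : 1 ≤ c := by
    by_contra! hc
    nlinarith [mul_nonneg (by linarith : 0 ≤ -c) (by linarith : 0 ≤ t ^ 2 - 1)]
  rcases hR with rfl | hR
  · refine ⟨rfl, ?_⟩
    obtain rfl : t = P := by linarith
    have hc3 : c ≤ 3 := by
      by_contra! hc
      nlinarith [mul_nonneg (by linarith : 0 ≤ c - 4) (by linarith : 0 ≤ t ^ 2 - 1)]
    obtain ⟨u, hu⟩ : ∃ u, u = c * t - 3 * j := ⟨_, rfl⟩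
    have hPu : t * u = 3 * i + c := by rw [hu]; linarith
    have hu1 : 1 ≤ u := by
      by_contra! h'
      nlinarith
    have hu3 : u ≤ 3 := by
      by_contra! h'
      nlinarith
    obtain rfl | rfl | rfl : c = 1 ∨ c = 2 ∨ c = 3 := by omega
    all_goals obtain rfl | rfl | rfl : u = 1 ∨ u = 2 ∨ u = 3 := by omega
    all_goals omega
  · exfalso
    nlinarith [mul_nonneg (by linarith : 0 ≤ c - 1) (by linarith : 0 ≤ t ^ 2 - 1),
        mul_nonneg (by linarith : 0 ≤ R - 4) (by linarith : 0 ≤ P),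
        mul_nonneg (by nlinarith : 0 ≤ t - 4 * P) (by linarith : 0 ≤ t - 1)]

lemma two_pow_mod_three_of_odd {m : ℕ} (hm : Odd m) : 2 ^ m % 3 = 2 := by
  obtain ⟨k, rfl⟩ := hm
  rw [pow_succ, pow_mul, Nat.mul_mod, Nat.pow_mod]
  norm_num

lemma two_pow_mod_three_of_even {m : ℕ} (hm : Even m) : 2 ^ m % 3 = 1 := by
  obtain ⟨k, rfl⟩ := hm
  rw [← two_mul, pow_mul, Nat.pow_mod]
  norm_num

lemma neg_two_pow_mul_eq_cases {m n l i j : ℕ} (hm : 5 ≤ m) (hodd : Odd m)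
    (hn : 3 * n + 1 = 4 ^ m) (hl : l ≤ m) (hi1 : 1 ≤ i) (hi : i < 2 ^ m) (hj1 : 1 ≤ j)
    (hj : j < 2 ^ m) (h : (-2 : ZMod n) ^ l * j = i) :
    (Even l ∧ i = 2 ^ l * j) ∨ (3 * i = 2 ^ m + 1 ∧ 3 * j = 2 * 2 ^ m + 2) ∨
      (3 * j = 2 * 2 ^ m + 5 ∧ 6 * i = 5 * 2 ^ m + 2) ∨
      (l = m ∧ i + 1 = 2 ^ m ∧ j + 1 = 2 ^ m) ∨ (3 * i + 1 = 2 * 2 ^ m ∧ 3 * j + 2 = 2 ^ m) ∨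
      (3 * i + 2 = 2 ^ m ∧ 3 * j + 1 = 2 * 2 ^ m) := by
  have hPR : (2 : ℤ) ^ m = 2 ^ l * 2 ^ (m - l) := by rw [← pow_add, Nat.add_sub_cancel' hl]
  have hn' : 3 * (n : ℤ) = (2 ^ m) ^ 2 - 1 := by
    have : 3 * (n : ℤ) + 1 = 4 ^ m := by exact_mod_cast hn
    rw [← pow_mul, mul_comm m 2, pow_mul]
    norm_num
    linarith
  have hi' : (i : ℤ) < 2 ^ m := by exact_mod_cast hi
  have hj' : (j : ℤ) < 2 ^ m := by exact_mod_cast hj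
  have ht : (2 : ℤ) ^ 5 ≤ 2 ^ m := pow_le_pow_right₀ (by norm_num) hm
  have ht3 : (2 : ℤ) ^ m % 3 = 2 := by exact_mod_cast two_pow_mod_three_of_odd hodd
  rcases Nat.even_or_odd l with he | ho
  · rcases Nat.eq_zero_or_pos l with rfl | hl0
    · left
      refine ⟨he, ?_⟩
      rw [pow_zero, one_mul] at h ⊢
      have h4 : 2 ^ m ≤ n := by
        zify
        nlinarith
      rw [ZMod.natCast_eq_natCast_iff', Nat.mod_eq_of_lt (by omega), Nat.mod_eq_of_lt (by omega)]
        at h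
      exact h.symm
    · rw [he.neg_pow] at h
      obtain ⟨c, hc⟩ : (n : ℤ) ∣ 2 ^ l * j - i := by
        rw [← ZMod.intCast_zmod_eq_zero_iff_dvd]
        push_cast
        rw [h, sub_self]
      have hl2 : 2 ≤ l := by
        obtain ⟨k, rfl⟩ := he
        omega
      have hml : Odd (m - l) := Nat.Odd.sub_even hl hodd he
      have hR : (2 : ℤ) ^ (m - l) = 2 ∨ (8 : ℤ) ≤ 2 ^ (m - l) := by
        obtain ⟨k, hk⟩ := hml
        rcases Nat.eq_zero_or_pos k with rfl | hk0
        · left; rw [hk]; norm_num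
        · right
          calc (8 : ℤ) = 2 ^ 3 := by norm_num
            _ ≤ _ := pow_le_pow_right₀ (by norm_num) (by omega)
      have := even_power_relation (c := c) hPR
        (calc (4 : ℤ) = 2 ^ 2 := by norm_num
            _ ≤ _ := pow_le_pow_right₀ (by norm_num) hl2)
        (by exact_mod_cast two_pow_mod_three_of_even he) hR (by exact_mod_cast hi1) hi'
        (by exact_mod_cast hj1) hj' (by rw [hc, ← hn']; ring)
      norm_cast at this
      rcases this with h | h | h
      · exact Or.inl ⟨he, h⟩
      · exact Or.inr (Or.inl h)
      · exact Or.inr (Or.inr (Or.inl h))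
  · rw [ho.neg_pow] at h
    obtain ⟨c, hc⟩ : (n : ℤ) ∣ 2 ^ l * j + i := by
      rw [← ZMod.intCast_zmod_eq_zero_iff_dvd]
      push_cast
      rw [← h]
      ring
    have hml : Even (m - l) := Nat.Odd.sub_odd hodd ho
    have hl1 : 1 ≤ l := ho.pos
    have hR : (2 : ℤ) ^ (m - l) = 1 ∨ (4 : ℤ) ≤ 2 ^ (m - l) := by
      obtain ⟨k, hk⟩ := hml
      rcases Nat.eq_zero_or_pos k with rfl | hk0
      · left; rw [hk]; norm_num
      · right
        calc (4 : ℤ) = 2 ^ 2 := by norm_num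
          _ ≤ _ := pow_le_pow_right₀ (by norm_num) (by omega)
    obtain ⟨h1, h⟩ := odd_power_relation (c := c) hPR
      (calc (2 : ℤ) = 2 ^ 1 := by norm_num
          _ ≤ _ := pow_le_pow_right₀ (by norm_num) hl1) hR (by linarith) ht3
      (by exact_mod_cast hi1) hi' (by exact_mod_cast hj1) hj' (by rw [hc, ← hn']; ring)
    have hlm : l = m := by
      by_contra hne
      have : (2 : ℤ) ^ 1 ≤ 2 ^ (m - l) := pow_le_pow_right₀ (by norm_num) (by omega)
      linarith
    zify
    generalize (2 : ℤ) ^ m = t at *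
    omega

/-- If `j ≤ i` lie in the same orbit of multiplication by `-2` and `4 ∤ i`, then `i` is
exceptional or the relation is trivial. -/
lemma same_orbit_cases {m n l i j : ℕ} (hm : 5 ≤ m) (hodd : Odd m)
    (hn : 3 * n + 1 = 4 ^ m) (hl : l < 2 * m) (hi : i < 2 ^ m) (hj1 : 1 ≤ j)
    (hji : j ≤ i) (hi4 : ¬ 4 ∣ i) (h : (-2 : ZMod n) ^ l * j = i) :
    (l = 0 ∧ j = i) ∨
      (j < i ∧ (3 * i = 2 * 2 ^ m + 2 ∨ 6 * i = 5 * 2 ^ m + 2 ∨ 3 * i + 1 = 2 * 2 ^ m)) ∨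
      (l = m ∧ i + 1 = 2 ^ m ∧ j = i) := by
  have ht : 2 ^ 5 ≤ 2 ^ m := Nat.pow_le_pow_right (by norm_num) hm
  rcases le_or_gt l m with hlm | hlm
  · rcases neg_two_pow_mul_eq_cases hm hodd hn hlm (by omega) hi hj1 (by omega) h with
      ⟨he, h⟩ | h
    · rcases Nat.eq_zero_or_pos l with rfl | hl0
      · left; simpa using h.symm
      · obtain ⟨k, rfl⟩ := he
        refine absurd ?_ hi4
        rw [h]
        exact Dvd.dvd.mul_right ((by norm_num : 4 = 2 ^ 2) ▸ pow_dvd_pow 2 (by omega)) _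
    · omega
  · have h' : (-2 : ZMod n) ^ (2 * m - l) * i = j := by
      rw [← h, ← mul_assoc, ← pow_add, Nat.sub_add_cancel hl.le, pow_mul]
      have : ((3 * n + 1 : ℕ) : ZMod n) = 4 ^ m := by rw [hn]; push_cast; rfl
      push_cast at this
      norm_num at this ⊢
      rw [← this, one_mul]
    rcases neg_two_pow_mul_eq_cases hm hodd hn (by omega : 2 * m - l ≤ m) hj1 (by omega)
      (by omega) hi h' with ⟨he, h⟩ | h
    · have : 2 ^ 1 ≤ 2 ^ (2 * m - l) := Nat.pow_le_pow_right (by norm_num) (by omega)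
      nlinarith
    · omega

/-- The orbit of `i` under multiplication by `-2` modulo `n`. -/
def negTwoOrbit (n i : ℕ) : Set (ZMod n) := Set.range fun l : ℕ => (-2) ^ l * (i : ZMod n)

/-- The union of the orbits of `0, …, d - 1` under multiplication by `-2` modulo `n`. -/
def negTwoOrbits (n d : ℕ) : Set (ZMod n) := {k | ∃ i < d, k ∈ negTwoOrbit n i}

lemma negTwoOrbits_one (n : ℕ) : negTwoOrbits n 1 = {0} := by
  ext k
  simp [negTwoOrbits, negTwoOrbit, eq_comm]

lemma negTwoOrbits_succ (n d : ℕ) :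
    negTwoOrbits n (d + 1) = negTwoOrbits n d ∪ negTwoOrbit n d := by
  ext k
  simp only [negTwoOrbits, Set.mem_ofPred_eq, Set.mem_union, Order.lt_add_one_iff, le_iff_lt_or_eq,
    or_and_right, exists_or, exists_eq_left]

lemma neg_two_pow_mul_mem_negTwoOrbits {n d : ℕ} {k : ZMod n} (hk : k ∈ negTwoOrbits n d)
    (l : ℕ) : (-2) ^ l * k ∈ negTwoOrbits n d := by
  obtain ⟨i, hi, j, rfl⟩ := hk
  exact ⟨i, hi, l + j, by simp only [pow_add, mul_assoc]⟩

lemma neg_two_pow_two_mul {m n : ℕ} (hn : 3 * n + 1 = 4 ^ m) : (-2 : ZMod n) ^ (2 * m) = 1 := by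
  have : ((3 * n + 1 : ℕ) : ZMod n) = 4 ^ m := by rw [hn]; push_cast; rfl
  push_cast at this
  rw [pow_mul]
  norm_num at this ⊢
  exact this.symm

lemma neg_two_mul_mem_negTwoOrbits_iff {m n d : ℕ} (hm : 1 ≤ m) (hn : 3 * n + 1 = 4 ^ m)
    {k : ZMod n} : -2 * k ∈ negTwoOrbits n d ↔ k ∈ negTwoOrbits n d := by
  refine ⟨fun h => ?_, fun h => by simpa using neg_two_pow_mul_mem_negTwoOrbits h 1⟩
  have := neg_two_pow_mul_mem_negTwoOrbits h (2 * m - 1)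
  rwa [← mul_assoc, ← pow_succ, Nat.sub_add_cancel (by omega), neg_two_pow_two_mul hn,
    one_mul] at this

lemma negTwoOrbit_subset {n i j l : ℕ} (h : (-2 : ZMod n) ^ l * j = i) :
    negTwoOrbit n i ⊆ negTwoOrbit n j := by
  rintro _ ⟨r, rfl⟩
  exact ⟨r + l, by simp only [pow_add, mul_assoc, h]⟩

lemma negTwoOrbits_succ_of_eq {n i j l : ℕ} (hij : j < i) (h : (-2 : ZMod n) ^ l * j = i) :
    negTwoOrbits n (i + 1) = negTwoOrbits n i := by
  rw [negTwoOrbits_succ, Set.union_eq_left]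
  exact fun k hk => ⟨j, hij, negTwoOrbit_subset h hk⟩

/-- The indices `i` with `4 ∤ i` whose orbit already contains a smaller index. -/
def IsExceptional (m i : ℕ) : Prop :=
  3 * i = 2 * 2 ^ m + 2 ∨ 6 * i = 5 * 2 ^ m + 2 ∨ 3 * i + 1 = 2 * 2 ^ m

section

variable {m n i : ℕ}

lemma negTwoOrbit_eq_image {r : ℕ} (hr : 1 ≤ r)
    (h : (-2 : ZMod n) ^ r * i = i) :
    negTwoOrbit n i = (fun l : ℕ => (-2) ^ l * (i : ZMod n)) '' (Finset.range r) := by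
  ext k
  constructor
  · rintro ⟨l, rfl⟩
    refine ⟨l % r, by simpa using Nat.mod_lt _ hr, ?_⟩
    have hpow : ∀ q : ℕ, ((-2 : ZMod n) ^ r) ^ q * i = i := by
      intro q
      induction q with
      | zero => simp
      | succ q ih => rw [pow_succ, mul_assoc, h, ih]
    conv_rhs => rw [← Nat.mod_add_div l r]
    simp only [pow_add, pow_mul, mul_assoc, hpow]
  · rintro ⟨l, -, rfl⟩
    exact ⟨l, rfl⟩

lemma ncard_negTwoOrbit (hm : 1 ≤ m) (hn : 3 * n + 1 = 4 ^ m) {r : ℕ} (hr : 1 ≤ r)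
    (h : (-2 : ZMod n) ^ r * i = i)
    (hinj : ∀ l, 1 ≤ l → l < r → (-2 : ZMod n) ^ l * i ≠ i) : (negTwoOrbit n i).ncard = r := by
  rw [negTwoOrbit_eq_image hr h, Set.InjOn.ncard_image, Set.ncard_coe_finset,
    Finset.card_range]
  have key : ∀ a b : ℕ, a < b → b < r → (-2 : ZMod n) ^ a * i ≠ (-2) ^ b * i := by
    intro a b hab hb heq
    refine hinj (b - a) (by omega) (by omega) ?_
    have h2 : IsUnit ((-2 : ZMod n) ^ a) :=
      (IsUnit.of_pow_eq_one (neg_two_pow_two_mul hn) (by omega)).pow a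
    rw [← h2.mul_right_inj, heq, ← mul_assoc, ← pow_add, Nat.add_sub_cancel' hab.le]
  intro a ha b hb hab
  simp only [Finset.coe_range, Set.mem_Iio] at ha hb
  rcases lt_trichotomy a b with hlt | rfl | hlt
  · exact absurd hab (key a b hlt hb)
  · rfl
  · exact absurd hab.symm (key b a hlt ha)

lemma ncard_negTwoOrbits_succ [NeZero n] (hm : 5 ≤ m) (hodd : Odd m) (hn : 3 * n + 1 = 4 ^ m)
    (hi1 : 1 ≤ i) (hi : i < 2 ^ m) (hi4 : ¬ 4 ∣ i) (hexc : ¬ IsExceptional m i) :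
    (negTwoOrbits n (i + 1)).ncard = (negTwoOrbits n i).ncard + (negTwoOrbit n i).ncard := by
  rw [negTwoOrbits_succ, Set.ncard_union_eq ?_ (Set.toFinite _) (Set.toFinite _)]
  rw [Set.disjoint_right]
  rintro _ ⟨r, rfl⟩ h
  have h' := neg_two_pow_mul_mem_negTwoOrbits h (2 * m * r - r)
  rw [← mul_assoc, ← pow_add, Nat.sub_add_cancel (by nlinarith), pow_mul,
    neg_two_pow_two_mul hn, one_pow, one_mul] at h'
  obtain ⟨j, hj, hij⟩ := h'
  have hper : (-2 : ZMod n) ^ (2 * m) * j = j := by rw [neg_two_pow_two_mul hn, one_mul]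
  rw [negTwoOrbit_eq_image (by omega : 1 ≤ 2 * m) hper] at hij
  obtain ⟨l, hl, hl'⟩ := hij
  simp only [Finset.coe_range, Set.mem_Iio] at hl hl'
  rcases Nat.eq_zero_or_pos j with rfl | hj0
  · have h4 : 2 ^ m ≤ n := by
      have ht : 2 ^ 5 ≤ 2 ^ m := Nat.pow_le_pow_right (by norm_num) hm
      have : 4 ^ m = 2 ^ m * 2 ^ m := by rw [← mul_pow]; norm_num
      nlinarith
    rw [Nat.cast_zero, mul_zero, eq_comm, ZMod.natCast_eq_zero_iff] at hl'
    have := Nat.le_of_dvd hi1 hl'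
    omega
  · rcases same_orbit_cases hm hodd hn hl hi hj0 hj.le hi4 hl' with h | h | h
    · omega
    · exact hexc h.2
    · omega

lemma ncard_negTwoOrbit_of_lt (hm : 5 ≤ m) (hodd : Odd m) (hn : 3 * n + 1 = 4 ^ m)
    (hi1 : 1 ≤ i) (hi : i + 1 < 2 ^ m) (hi4 : ¬ 4 ∣ i) : (negTwoOrbit n i).ncard = 2 * m := by
  refine ncard_negTwoOrbit (by omega) hn (by omega)
    (by rw [neg_two_pow_two_mul hn, one_mul]) fun l hl1 hl h => ?_
  rcases same_orbit_cases hm hodd hn hl (by omega) hi1 le_rfl hi4 h with h | h | h <;> omega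

lemma ncard_negTwoOrbit_of_eq (hm : 5 ≤ m) (hodd : Odd m) (hn : 3 * n + 1 = 4 ^ m)
    (hi : i + 1 = 2 ^ m) : (negTwoOrbit n i).ncard = m := by
  have ht : 2 ^ 5 ≤ 2 ^ m := Nat.pow_le_pow_right (by norm_num) hm
  have h4 : 2 ^ 2 ∣ 2 ^ m := pow_dvd_pow 2 (by omega)
  refine ncard_negTwoOrbit (by omega) hn (by omega) ?_ fun l hl1 hl h => ?_
  · have hi' : (i : ZMod n) + 1 = 2 ^ m := by exact_mod_cast congrArg (Nat.cast : ℕ → ZMod n) hi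
    have hsq := neg_two_pow_two_mul hn
    rw [two_mul, pow_add, hodd.neg_pow, ← hi'] at hsq
    rw [hodd.neg_pow, ← hi']
    linear_combination -hsq
  · rcases same_orbit_cases hm hodd hn (by omega) (by omega) (by omega) le_rfl (by omega) h with
      h | h | h <;> omega

lemma exists_smaller_of_isExceptional (hm : 5 ≤ m) (hodd : Odd m) (hn : 3 * n + 1 = 4 ^ m)
    (h : IsExceptional m i) : ∃ j < i, ∃ l : ℕ, (-2 : ZMod n) ^ l * j = i := by
  have ht : 2 ^ 5 ≤ 2 ^ m := Nat.pow_le_pow_right (by norm_num) hm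
  have ht3 := two_pow_mod_three_of_odd hodd
  have hsq : 3 * n + 1 = 2 ^ m * 2 ^ m := by rw [hn, ← mul_pow]; norm_num
  rcases h with h | h | h
  · obtain ⟨j, hj⟩ : ∃ j, 3 * j = 2 ^ m + 1 := ⟨(2 ^ m + 1) / 3, by omega⟩
    refine ⟨j, by omega, m + 1, ?_⟩
    rw [hodd.add_one.neg_pow]
    have : 2 ^ (m + 1) * j = 2 * n + i := by
      rw [pow_succ]
      nlinarith
    have := congrArg (Nat.cast : ℕ → ZMod n) this
    push_cast at this
    simpa using this
  · obtain ⟨j, hj⟩ : ∃ j, 3 * j = 2 * 2 ^ m + 5 := ⟨(2 * 2 ^ m + 5) / 3, by omega⟩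
    refine ⟨j, by omega, m - 1, ?_⟩
    rw [(Nat.Odd.sub_odd hodd odd_one).neg_pow]
    have : 2 ^ (m - 1) * j = n + i := by
      have : 2 ^ m = 2 ^ (m - 1) * 2 := by rw [← pow_succ, Nat.sub_add_cancel (by omega)]
      nlinarith
    have := congrArg (Nat.cast : ℕ → ZMod n) this
    push_cast at this
    simpa using this
  · obtain ⟨j, hj⟩ : ∃ j, 3 * j + 2 = 2 ^ m := ⟨(2 ^ m - 2) / 3, by omega⟩
    refine ⟨j, by omega, m, ?_⟩
    rw [hodd.neg_pow]
    have : 2 ^ m * j + i = n := by nlinarith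
    have := congrArg (Nat.cast : ℕ → ZMod n) this
    push_cast at this
    rw [ZMod.natCast_self] at this
    linear_combination -this

/-- The number of exceptional indices below `d`. -/
def exceptionalCount (m d : ℕ) : ℕ :=
  (if 2 * 2 ^ m < 3 * d + 1 then 1 else 0) + (if 2 * 2 ^ m + 2 < 3 * d then 1 else 0) +
    (if 5 * 2 ^ m + 2 < 6 * d then 1 else 0)

lemma ncard_negTwoOrbits (hm : 5 ≤ m) (hodd : Odd m) (hn : 3 * n + 1 = 4 ^ m) [NeZero n]
    (d : ℕ) (hd : d + 2 ≤ 2 ^ m) :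
    ((negTwoOrbits n (d + 1)).ncard : ℤ) =
      1 + 2 * m * (d - (d / 4 : ℕ) - exceptionalCount m (d + 1)) := by
  have ht : 2 ^ 5 ≤ 2 ^ m := Nat.pow_le_pow_right (by norm_num) hm
  have ht3 := two_pow_mod_three_of_odd hodd
  have ht4 : 2 ^ 3 ∣ 2 ^ m := pow_dvd_pow 2 (by omega)
  induction d with
  | zero =>
    have : exceptionalCount m (0 + 1) = 0 := by
      unfold exceptionalCount
      split_ifs <;> omega
    simp [this, negTwoOrbits_one]
  | succ d ih =>
    have ih := ih (by omega)
    by_cases h : 4 ∣ d + 1 ∨ IsExceptional m (d + 1)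
    · obtain ⟨j, hj, l, hl⟩ : ∃ j < d + 1, ∃ l : ℕ, (-2 : ZMod n) ^ l * j = (d + 1 : ℕ) := by
        rcases h with ⟨j, hj⟩ | h
        · refine ⟨j, by omega, 2, ?_⟩
          rw [hj]
          push_cast
          norm_num
        · exact exists_smaller_of_isExceptional hm hodd hn h
      rw [negTwoOrbits_succ_of_eq hj hl, ih]
      congr 2
      unfold exceptionalCount
      unfold IsExceptional at h
      split_ifs <;> push_cast <;> omega
    · rw [not_or] at h
      rw [ncard_negTwoOrbits_succ hm hodd hn (by omega) (by omega) h.1 h.2, Nat.cast_add, ih,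
        ncard_negTwoOrbit_of_lt hm hodd hn (by omega) (by omega) h.1]
      have : ((d + 1 : ℕ) : ℤ) - ((d + 1) / 4 : ℕ) - exceptionalCount m (d + 1 + 1) =
          d - (d / 4 : ℕ) - exceptionalCount m (d + 1) + 1 := by
        unfold exceptionalCount
        unfold IsExceptional at h
        split_ifs <;> push_cast <;> omega
      rw [this]
      push_cast
      ring

lemma ncard_negTwoOrbits_two_pow (hm : 5 ≤ m) (hodd : Odd m) (hn : 3 * n + 1 = 4 ^ m)
    [NeZero n] {d : ℕ} (hd : d + 1 = 2 ^ m) :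
    (negTwoOrbits n (d + 1)).ncard = (negTwoOrbits n d).ncard + m := by
  have ht : 2 ^ 5 ≤ 2 ^ m := Nat.pow_le_pow_right (by norm_num) hm
  have ht4 : 2 ^ 3 ∣ 2 ^ m := pow_dvd_pow 2 (by omega)
  rw [ncard_negTwoOrbits_succ hm hodd hn (by omega) (by omega) (by omega)
    (by unfold IsExceptional; omega), ncard_negTwoOrbit_of_eq hm hodd hn hd]

end

section GeneralCyclic

variable {F : Type*} [Field F] {E : Type*} [Field E] [Algebra F E]

lemma aeval_pow_card_pow_minpoly [Fintype F] (x : E) (j : ℕ) :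
    aeval (x ^ Fintype.card F ^ j) (minpoly F x) = 0 := by
  induction j with
  | zero => simp
  | succ j ih =>
    rw [pow_succ, pow_mul, ← expand_aeval, FiniteField.expand_card, map_pow, ih,
      zero_pow Fintype.card_ne_zero]

/-- The roots of the minimal polynomial of `x` over a finite field are Frobenius conjugates
of `x`. -/
lemma exists_eq_pow_of_aeval_minpoly_eq_zero [Fintype F] {x y : E} (hx : IsIntegral F x)
    (hy : aeval y (minpoly F x) = 0) : ∃ j : ℕ, y = x ^ Fintype.card F ^ j := by
  classical
  let K := IntermediateField.adjoin F {x}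
  have : FiniteDimensional F K := IntermediateField.adjoin.finiteDimensional hx
  have : Finite K := Module.finite_of_finite F
  have : Fintype K := Fintype.ofFinite K
  let x' : K := IntermediateField.AdjoinSimple.gen F x
  have hx' : IsIntegral F x' := Algebra.IsIntegral.isIntegral x'
  have hmin : minpoly F x' = minpoly F x := IntermediateField.minpoly_gen F x
  have hsplit : (minpoly F x).map (algebraMap F K) |>.Splits := by
    rw [← hmin]
    exact Normal.splits inferInstance x'
  obtain ⟨y', rfl⟩ : y ∈ (algebraMap K E).range := by
    refine hsplit.mem_range_of_isRoot (i := algebraMap K E)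
      ((Polynomial.map_ne_zero (minpoly.ne_zero hx))) ?_
    rw [Polynomial.map_map, ← IsScalarTower.algebraMap_eq, IsRoot, eval_map_algebraMap, hy]
  rw [aeval_algebraMap_apply, map_eq_zero, ← hmin] at hy
  obtain ⟨σ, hσ⟩ := minpoly.exists_algEquiv_of_root' hx'.isAlgebraic hy
  obtain ⟨j, rfl⟩ := (FiniteField.bijective_frobeniusAlgEquivOfAlgebraic_pow F K).2 σ
  refine ⟨j, ?_⟩
  rw [← hσ]
  simp only [AlgEquiv.coe_pow, FiniteField.coe_frobeniusAlgEquivOfAlgebraic_iterate, map_pow]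
  rfl

lemma prod_minpoly_dvd_iff [DecidableEq F] {ι : Type*} (T : Finset ι) (a : ι → E)
    (ha : ∀ i, IsIntegral F (a i)) (f : F[X]) :
    ∏ p ∈ T.image (fun i => minpoly F (a i)), p ∣ f ↔ ∀ i ∈ T, aeval (a i) f = 0 := by
  constructor
  · intro h i hi
    exact aeval_eq_zero_of_dvd_aeval_eq_zero
      ((Finset.dvd_prod_of_mem _ (Finset.mem_image_of_mem _ hi)).trans h) (minpoly.aeval F _)
  · intro h
    refine Finset.prod_dvd_of_coprime ?_ ?_
    · intro p hp q hq hpq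
      simp only [Finset.coe_image, Set.mem_image] at hp hq
      obtain ⟨i, -, rfl⟩ := hp
      obtain ⟨j, -, rfl⟩ := hq
      refine (minpoly.irreducible (ha i)).coprime_iff_not_dvd.2 fun hdvd => hpq ?_
      exact eq_of_monic_of_associated (minpoly.monic (ha i)) (minpoly.monic (ha j))
        ((minpoly.irreducible (ha i)).associated_of_dvd (minpoly.irreducible (ha j)) hdvd)
    · intro p hp
      obtain ⟨i, hi, rfl⟩ := Finset.mem_image.1 hp
      exact minpoly.dvd F _ (h i hi)

variable {n : ℕ}

lemma finrank_cyclicCodeOf {g : F[X]} (hg0 : g ≠ 0) (hg : g.natDegree ≤ n) :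
    Module.finrank F (cyclicCodeOf n g) = n - g.natDegree := by
  let φ : (Fin n → F) →ₗ[F] AdjoinRoot g :=
    { toFun := fun c => AdjoinRoot.mk g (polyOfVec c)
      map_add' := fun a b => by
        simp [polyOfVec, add_mul, Finset.sum_add_distrib]
      map_smul' := fun r a => by
        simp [polyOfVec, Finset.mul_sum, mul_assoc, Algebra.smul_def, AdjoinRoot.algebraMap_eq] }
  have hker : LinearMap.ker φ = cyclicCodeOf n g := by
    ext c
    exact AdjoinRoot.mk_eq_zero
  have hsurj : LinearMap.range φ = ⊤ := by
    rw [LinearMap.range_eq_top]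
    intro y
    obtain ⟨p, rfl⟩ := AdjoinRoot.mk_surjective y
    refine ⟨fun i => (p % g).coeff i, ?_⟩
    have : polyOfVec (fun i : Fin n => (p % g).coeff i) = p % g := by
      rcases eq_or_ne (p % g) 0 with h0 | h0
      · simp [polyOfVec, h0]
      rw [polyOfVec, Fin.sum_univ_eq_sum_range (fun i => C ((p % g).coeff i) * X ^ i) n]
      refine (as_sum_range_C_mul_X_pow' _ ?_).symm
      exact (natDegree_lt_natDegree h0 (EuclideanDomain.mod_lt p hg0)).trans_le hg
    change AdjoinRoot.mk g (polyOfVec _) = _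
    rw [this, AdjoinRoot.mk_eq_mk]
    exact ⟨-(p / g), by linear_combination EuclideanDomain.div_add_mod p g⟩
  have := φ.finrank_range_add_finrank_ker
  rw [hker, hsurj, finrank_top, (AdjoinRoot.powerBasis hg0).finrank, AdjoinRoot.powerBasis_dim,
    Module.finrank_fin_fun] at this
  omega

lemma sum_fin_natCast [NeZero n] {A : Type*} [AddCommMonoid A] (f : ZMod n → A) :
    ∑ i : Fin n, f ((i : ℕ) : ZMod n) = ∑ x, f x := by
  refine Fintype.sum_bijective (fun i : Fin n => ((i : ℕ) : ZMod n)) ⟨fun a b h => ?_, fun x => ?_⟩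
    _ _ fun _ => rfl
  · rw [ZMod.natCast_eq_natCast_iff', Nat.mod_eq_of_lt a.is_lt, Nat.mod_eq_of_lt b.is_lt] at h
    exact Fin.ext h
  · exact ⟨⟨x.val, x.val_lt⟩, by simp⟩

variable [NeZero n] {β : E} (hβ : IsPrimitiveRoot β n)

/-- The character `k ↦ β ^ k` of `ZMod n` attached to a primitive `n`-th root of unity `β`. -/
def rootChar (hβ : IsPrimitiveRoot β n) : AddChar (ZMod n) E := AddChar.zmodChar n hβ.pow_eq_one

include hβ in
lemma rootChar_injective : Function.Injective (rootChar hβ) := by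
  intro a b h
  exact ZMod.val_injective n (hβ.pow_inj (ZMod.val_lt a) (ZMod.val_lt b) h)

lemma rootChar_natCast (i : ℕ) : rootChar hβ i = β ^ i := AddChar.zmodChar_apply' _ i

lemma rootChar_intCast (s : ℤ) : rootChar hβ s = β ^ s := by
  have h1 : rootChar hβ 1 = β := by simpa using rootChar_natCast hβ 1
  rw [← zsmul_one, AddChar.map_zsmul_eq_zpow, h1]

lemma rootChar_pow (k : ZMod n) (i : ℕ) : rootChar hβ k ^ i = rootChar hβ (k * i) := by
  rw [← AddChar.map_nsmul_eq_pow, nsmul_eq_mul, mul_comm]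

lemma aeval_rootChar_polyOfVec (k : ZMod n) (c : Fin n → F) :
    aeval (rootChar hβ k) (polyOfVec c) =
      ∑ i : Fin n, algebraMap F E (c i) * rootChar hβ (k * (i : ℕ)) := by
  simp [polyOfVec, rootChar_pow]

/-- The BCH bound. -/
lemma bch_bound [DecidableEq F] {c : Fin n → F} (hc : c ≠ 0) (b : ZMod n) (M : ℕ)
    (h : ∀ j < M, aeval (rootChar hβ (b + j)) (polyOfVec c) = 0) : M + 1 ≤ hammingNorm c := by
  by_contra! hlt
  set T := Finset.univ.filter fun i => c i ≠ 0 with hT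
  have hw : T.card = hammingNorm c := rfl
  let e := T.equivFin
  let f : Fin T.card → E := fun a => rootChar hβ (((e.symm a : Fin n) : ℕ) : ZMod n)
  let v : Fin T.card → E := fun a => algebraMap F E (c (e.symm a)) *
    rootChar hβ (b * (((e.symm a : Fin n) : ℕ) : ZMod n))
  have hf : Function.Injective f := by
    intro x y hxy
    have := rootChar_injective hβ hxy
    rw [ZMod.natCast_eq_natCast_iff', Nat.mod_eq_of_lt (Fin.is_lt _),
      Nat.mod_eq_of_lt (Fin.is_lt _)] at this
    exact e.symm.injective (Subtype.ext (Fin.ext this))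
  have hv : v = 0 := by
    refine Matrix.eq_zero_of_forall_pow_sum_mul_pow_eq_zero hf fun j => ?_
    have hj := h j (by omega)
    rw [aeval_rootChar_polyOfVec, ← Finset.sum_subset (Finset.subset_univ T), ← Finset.sum_coe_sort,
      ← e.symm.sum_comp] at hj
    · rw [← hj]
      refine Finset.sum_congr rfl fun a _ => ?_
      simp only [v, f]
      rw [rootChar_pow, mul_assoc, ← AddChar.map_add_eq_mul]
      congr 2
      ring
    · intro i _ hi
      have : c i = 0 := by simpa [hT] using hi
      simp [this]
  obtain ⟨i, hi⟩ := Function.ne_iff.1 hc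
  have hiT : i ∈ T := by simpa [hT] using hi
  have := congrFun hv (e ⟨i, hiT⟩)
  simp only [v, Equiv.symm_apply_apply, Pi.zero_apply, mul_eq_zero, map_eq_zero] at this
  exact this.elim hi (by
    intro h0
    exact (AddChar.val_isUnit (rootChar hβ) _).ne_zero h0)

section DefiningSet

variable {g : F[X]} (hdvd : g ∣ X ^ n - 1) {Z : Set (ZMod n)}
  (hZ : ∀ k, aeval (rootChar hβ k) g = 0 ↔ k ∈ Z)

include hdvd

omit [Field E] [Algebra F E] in
lemma generator_ne_zero : g ≠ 0 := by
  rintro rfl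
  exact (X_pow_sub_C_ne_zero (NeZero.pos n) (1 : F)) (by simpa using hdvd)

omit [Field E] [Algebra F E] in
lemma natDegree_generator_le : g.natDegree ≤ n := by
  have := natDegree_le_of_dvd hdvd (by simpa using X_pow_sub_C_ne_zero (NeZero.pos n) (1 : F))
  rwa [← C_1, natDegree_X_pow_sub_C] at this

omit [NeZero n] in
lemma map_generator_dvd : g.map (algebraMap F E) ∣ X ^ n - 1 := by
  simpa using Polynomial.map_dvd (algebraMap F E) hdvd

include hβ

lemma splits_generator : (g.map (algebraMap F E)).Splits :=
  (X_pow_sub_one_splits hβ).of_dvd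
    (by simpa using X_pow_sub_C_ne_zero (NeZero.pos n) (1 : E)) (map_generator_dvd hdvd)

lemma nodup_roots_generator : (g.map (algebraMap F E)).roots.Nodup := by
  refine Multiset.nodup_of_le (roots.le_of_dvd ?_ (map_generator_dvd hdvd)) ?_
  · simpa using X_pow_sub_C_ne_zero (NeZero.pos n) (1 : E)
  · simpa [nthRoots] using hβ.nthRoots_one_nodup

include hZ

lemma roots_generator : {x | x ∈ (g.map (algebraMap F E)).roots} = rootChar hβ '' Z := by
  ext x
  have h0 : g.map (algebraMap F E) ≠ 0 := Polynomial.map_ne_zero (generator_ne_zero hdvd)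
  simp only [Set.mem_ofPred_eq, mem_roots h0, IsRoot, eval_map_algebraMap, Set.mem_image]
  constructor
  · intro h
    have hx : x ^ n = 1 := by
      have := aeval_eq_zero_of_dvd_aeval_eq_zero hdvd h
      simpa [sub_eq_zero] using this
    obtain ⟨i, hi, rfl⟩ := hβ.eq_pow_of_pow_eq_one hx
    rw [← rootChar_natCast hβ] at h
    exact ⟨i, (hZ _).1 h, rootChar_natCast hβ i⟩
  · rintro ⟨k, hk, rfl⟩
    exact (hZ k).2 hk

lemma natDegree_generator : g.natDegree = Z.ncard := by
  classical
  rw [← natDegree_map (algebraMap F E), (splits_generator hβ hdvd).natDegree_eq_card_roots,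
    ← Multiset.toFinset_card_of_nodup (nodup_roots_generator hβ hdvd),
    ← Set.ncard_image_of_injective Z (rootChar_injective hβ), ← roots_generator hβ hdvd hZ,
    ← Set.ncard_coe_finset]
  congr 1
  ext x
  simp

lemma mem_cyclicCodeOf_iff (c : Fin n → F) :
    c ∈ cyclicCodeOf n g ↔ ∀ k ∈ Z, aeval (rootChar hβ k) (polyOfVec c) = 0 := by
  change g ∣ polyOfVec c ↔ _
  refine ⟨fun h k hk => aeval_eq_zero_of_dvd_aeval_eq_zero h ((hZ k).2 hk), fun h => ?_⟩
  rcases eq_or_ne (polyOfVec c) 0 with h0 | h0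
  · simp [h0]
  rw [← Polynomial.map_dvd_map' (algebraMap F E)]
  refine (splits_generator hβ hdvd).dvd_of_roots_le_roots
    (Polynomial.map_ne_zero (generator_ne_zero hdvd)) ?_
  refine (Multiset.le_iff_subset (nodup_roots_generator hβ hdvd)).2 fun x hx => ?_
  have : x ∈ rootChar hβ '' Z := roots_generator hβ hdvd hZ ▸ hx
  obtain ⟨k, hk, rfl⟩ := this
  rw [mem_roots (Polynomial.map_ne_zero h0), IsRoot, eval_map_algebraMap]
  exact h k hk

/-- A cyclic code over `GF(4)` whose defining set is stable under multiplication by `-2` is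
Hermitian LCD. -/
lemma isHermitianLCD_cyclicCodeOf [Fintype F] (hF : Fintype.card F = 4)
    (hneg : ∀ k, -2 * k ∈ Z ↔ k ∈ Z) :
    IsHermitianLCD 2 ((cyclicCodeOf n g : Submodule F (Fin n → F)) : Set (Fin n → F)) := by
  classical
  have h2 : (2 : F) = 0 := by
    have : ((4 : ℕ) : F) = 0 := hF ▸ Nat.cast_card_eq_zero F
    have : (2 : F) ^ 2 = 0 := by rw [← this]; norm_num
    exact pow_eq_zero_iff two_ne_zero |>.1 this
  have : CharP E 2 := CharTwo.of_one_ne_zero_of_two_eq_zero one_ne_zero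
    (by rw [← map_ofNat (algebraMap F E), h2, map_zero])
  refine Set.eq_singleton_iff_unique_mem.2 ⟨⟨Submodule.zero_mem _, fun c _ => by simp⟩, ?_⟩
  rintro c ⟨hcC, hcD⟩
  have hvanish : ∀ k, aeval (rootChar hβ k) (polyOfVec c) = 0 := by
    intro k
    by_cases hk : k ∈ Z
    · exact (mem_cyclicCodeOf_iff hβ hdvd hZ c).1 hcC k hk
    have hdeg : g.natDegree < n := by
      rw [natDegree_generator hβ hdvd hZ]
      have := Set.ncard_lt_card (s := Z) (fun h => hk (h ▸ Set.mem_univ k))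
      rwa [Nat.card_zmod] at this
    have heval : ∀ a : ZMod n, aeval (rootChar hβ a) g =
        ∑ j : ZMod n, algebraMap F E (g.coeff j.val) * rootChar hβ (a * j) := by
      intro a
      rw [aeval_eq_sum_range' hdeg, ← Fin.sum_univ_eq_sum_range
        (fun i => g.coeff i • rootChar hβ a ^ i), ← sum_fin_natCast]
      refine Finset.sum_congr rfl fun i _ => ?_
      rw [ZMod.val_natCast_of_lt i.is_lt, rootChar_pow, Algebra.smul_def]
    let b : ZMod n → Fin n → F := fun r i => g.coeff (((i : ℕ) : ZMod n) - r).val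
    have hb : ∀ r, b r ∈ cyclicCodeOf n g := by
      intro r
      rw [mem_cyclicCodeOf_iff hβ hdvd hZ]
      intro a ha
      rw [aeval_rootChar_polyOfVec, sum_fin_natCast (fun i : ZMod n =>
        algebraMap F E (g.coeff (i - r).val) * rootChar hβ (a * i)),
        ← Equiv.sum_comp (Equiv.addRight r)]
      have h0 := (hZ a).2 ha
      rw [heval] at h0
      calc _ = (∑ j : ZMod n, algebraMap F E (g.coeff j.val) * rootChar hβ (a * j)) *
              rootChar hβ (a * r) := by
            rw [Finset.sum_mul]
            refine Finset.sum_congr rfl fun i _ => ?_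
            simp [mul_add, AddChar.map_add_eq_mul, mul_assoc]
        _ = 0 := by rw [h0, zero_mul]
    set B := ∑ j : ZMod n, algebraMap F E (g.coeff j.val) ^ 2 * rootChar hβ (-k * j) with hB
    have hB0 : B ≠ 0 := by
      intro h
      refine hk ((hneg k).1 ((hZ _).1 ?_))
      rw [heval, ← zero_pow (M₀ := E) two_ne_zero, ← h, hB, CharTwo.sum_sq]
      refine Finset.sum_congr rfl fun j _ => ?_
      rw [mul_pow, ← pow_mul, ← map_pow,
        show 2 * 2 = Fintype.card F from hF.symm, FiniteField.pow_card, ← AddChar.map_nsmul_eq_pow]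
      congr 2
      simp only [nsmul_eq_mul]
      push_cast
      ring
    have hprod : aeval (rootChar hβ k) (polyOfVec c) * B = 0 := by
      calc _ = ∑ i : Fin n, algebraMap F E (c i) * rootChar hβ (k * (i : ℕ)) *
              ∑ r : ZMod n, algebraMap F E (b r i) ^ 2 *
                rootChar hβ (-k * (((i : ℕ) : ZMod n) - r)) := by
            rw [aeval_rootChar_polyOfVec, Finset.sum_mul]
            refine Finset.sum_congr rfl fun i _ => ?_
            rw [hB, ← (Equiv.subLeft ((i : ℕ) : ZMod n)).sum_comp]
            rfl
        _ = ∑ r : ZMod n, rootChar hβ (k * r) *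
              algebraMap F E (∑ i : Fin n, c i * b r i ^ 2) := by
            simp only [Finset.mul_sum, map_sum]
            rw [Finset.sum_comm]
            refine Finset.sum_congr rfl fun r _ => Finset.sum_congr rfl fun i _ => ?_
            have : rootChar hβ (k * r) = rootChar hβ (k * (i : ℕ)) *
                rootChar hβ (-k * (((i : ℕ) : ZMod n) - r)) := by
              rw [← AddChar.map_add_eq_mul]
              congr 1
              ring
            rw [this, map_mul (algebraMap F E), map_pow (algebraMap F E)]
            ring
        _ = 0 := Finset.sum_eq_zero fun r _ => by rw [hcD _ (hb r), map_zero, mul_zero]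
    exact (mul_eq_zero.1 hprod).resolve_right hB0
  by_contra hc0
  have h1 := bch_bound hβ hc0 0 n fun j _ => hvanish _
  have h3 : hammingNorm c ≤ n := hammingNorm_le_card_fintype.trans_eq (Fintype.card_fin n)
  omega

end DefiningSet

lemma isIntegral_rootChar (k : ZMod n) : IsIntegral F (rootChar hβ k) := by
  refine ⟨X ^ n - C 1, monic_X_pow_sub_C 1 (NeZero.ne n), ?_⟩
  simp [rootChar_pow]

lemma aeval_rootChar_minpoly_eq_zero_iff [Fintype F] (k s : ZMod n) :
    aeval (rootChar hβ k) (minpoly F (rootChar hβ s)) = 0 ↔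
      ∃ j : ℕ, k = s * (Fintype.card F : ZMod n) ^ j := by
  constructor
  · intro h
    obtain ⟨j, hj⟩ := exists_eq_pow_of_aeval_minpoly_eq_zero (isIntegral_rootChar hβ s) h
    rw [rootChar_pow] at hj
    exact ⟨j, by simpa using rootChar_injective hβ hj⟩
  · rintro ⟨j, rfl⟩
    have := aeval_pow_card_pow_minpoly (F := F) (rootChar hβ s) j
    rwa [rootChar_pow, Nat.cast_pow] at this

end GeneralCyclic

/-- (Quaternary Hermitian LCD codes of length `(4ᵐ − 1)/3`, `m` odd.)
The cyclic code over `GF(4)` with generator polynomial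
`g = (x − 1)·g_{(n,δ,1)}·lcm(m_{n−2(δ−1)},…,m_{n−2})`, i.e. the lcm (= product of the
distinct values) of the minimal polynomials `m_s` for `s ∈ {0} ∪ {1,…,δ−1} ∪
{n−2(δ−1),…,n−2}`, is Hermitian LCD, has minimum distance `≥ δ + 1 + ⌊(δ−1)/2⌋`,
and has the stated dimension in each case. -/
theorem stmt18 {m n δ : ℕ} (hm : 5 ≤ m) (hmodd : m % 2 = 1) (hn : n = (4 ^ m - 1) / 3)
    (hδ1 : 2 ≤ δ) (hδ2 : δ ≤ 2 ^ m)
    {F : Type*} [Field F] [Fintype F] [DecidableEq F] (hF : Fintype.card F = 4)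
    {E : Type*} [Field E] [DecidableEq E] [Algebra F E] (β : E) (hβ : IsPrimitiveRoot β n)
    (g : Polynomial F)
    (hg : g = ∏ p ∈ ((insert ((0 : ℤ))
        (((Finset.Icc 1 (δ - 1)).image fun i : ℕ => (i : ℤ)) ∪
          ((Finset.Icc 1 (δ - 1)).image fun i : ℕ => (n : ℤ) - 2 * i))).image
            fun s : ℤ => minpoly F (β ^ s)), p) :
    IsHermitianLCD 2 ((cyclicCodeOf n g : Submodule F (Fin n → F)) : Set (Fin n → F)) ∧
    (∀ c ∈ cyclicCodeOf n g, c ≠ 0 → δ + 1 + (δ - 1) / 2 ≤ hammingNorm c) ∧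
    ((δ ≤ (2 ^ (m + 1) - 1) / 3 →
        (Module.finrank F (cyclicCodeOf n g) : ℤ)
          = (n : ℤ) - 2 * ((δ : ℤ) - ((δ - 1) / 4 : ℕ) - 1) * m - 1) ∧
      (δ = (2 ^ (m + 1) + 2) / 3 →
        (Module.finrank F (cyclicCodeOf n g) : ℤ)
          = (n : ℤ) - 2 * ((δ : ℤ) - ((δ - 1) / 4 : ℕ) - 2) * m - 1) ∧
      ((2 ^ (m + 1) + 2) / 3 + 1 ≤ δ → δ ≤ (2 ^ (m + 1) + 2 ^ (m - 1) + 1) / 3 →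
        (Module.finrank F (cyclicCodeOf n g) : ℤ)
          = (n : ℤ) - 2 * ((δ : ℤ) - ((δ - 1) / 4 : ℕ) - 3) * m - 1) ∧
      ((2 ^ (m + 1) + 2 ^ (m - 1) + 1) / 3 + 1 ≤ δ → δ ≤ 2 ^ m - 1 →
        (Module.finrank F (cyclicCodeOf n g) : ℤ)
          = (n : ℤ) - 2 * ((δ : ℤ) - ((δ - 1) / 4 : ℕ) - 4) * m - 1) ∧
      (δ = 2 ^ m →
        (Module.finrank F (cyclicCodeOf n g) : ℤ)
          = (n : ℤ) - 2 * ((δ : ℤ) - ((δ - 1) / 4 : ℕ)) * m + 9 * m - 1)) := by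
  classical
  have hodd : Odd m := Nat.odd_iff.2 hmodd
  have hn3 : 3 * n + 1 = 4 ^ m := by
    have : 4 ^ m % 3 = 1 := by rw [Nat.pow_mod]; norm_num
    generalize 4 ^ m = q at hn this ⊢
    omega
  have ht : 2 ^ 5 ≤ 2 ^ m := Nat.pow_le_pow_right (by norm_num) hm
  have ht3 := two_pow_mod_three_of_odd hodd
  have hn0 : n ≠ 0 := by
    have : 4 ^ 1 ≤ 4 ^ m := Nat.pow_le_pow_right (by norm_num) (by omega)
    omega
  have : NeZero n := ⟨hn0⟩
  simp only [← rootChar_intCast hβ] at hg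
  have hdvd : g ∣ X ^ n - 1 := by
    rw [hg, prod_minpoly_dvd_iff _ _ fun s => isIntegral_rootChar hβ _]
    intro s _
    simp [rootChar_pow]
  have hZ : ∀ k, aeval (rootChar hβ k) g = 0 ↔ k ∈ negTwoOrbits n δ := by
    intro k
    simp only [hg, map_prod, Finset.prod_eq_zero_iff, Finset.mem_image, exists_exists_and_eq_and,
      aeval_rootChar_minpoly_eq_zero_iff, hF]
    constructor
    · rintro ⟨s, hs, j, rfl⟩
      simp only [Finset.mem_insert, Finset.mem_union, Finset.mem_image, Finset.mem_Icc] at hs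
      rcases hs with rfl | ⟨i, hi, rfl⟩ | ⟨i, hi, rfl⟩
      · exact ⟨0, by omega, 0, by simp⟩
      · refine ⟨i, by omega, 2 * j, ?_⟩
        push_cast
        rw [pow_mul]
        norm_num [mul_comm]
      · refine ⟨i, by omega, 2 * j + 1, ?_⟩
        push_cast
        rw [pow_succ, pow_mul, ZMod.natCast_self]
        norm_num
        ring
    · rintro ⟨i, hi, l, rfl⟩
      rcases Nat.eq_zero_or_pos i with rfl | hi0
      · exact ⟨0, Finset.mem_insert_self _ _, 0, by simp⟩
      have hi' : i ∈ Finset.Icc 1 (δ - 1) := Finset.mem_Icc.2 ⟨hi0, by omega⟩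
      obtain ⟨j, rfl | rfl⟩ := l.even_or_odd'
      · refine ⟨i, Finset.mem_insert_of_mem (Finset.mem_union_left _
          (Finset.mem_image_of_mem _ hi')), j, ?_⟩
        push_cast
        rw [pow_mul]
        norm_num [mul_comm]
      · refine ⟨n - 2 * i, Finset.mem_insert_of_mem (Finset.mem_union_right _
          (Finset.mem_image_of_mem (fun i : ℕ => (n : ℤ) - 2 * i) hi')), j, ?_⟩
        push_cast
        rw [pow_succ, pow_mul, ZMod.natCast_self]
        norm_num
        ring
  have hneg : ∀ k : ZMod n, -2 * k ∈ negTwoOrbits n δ ↔ k ∈ negTwoOrbits n δ :=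
    fun k => neg_two_mul_mem_negTwoOrbits_iff (by omega) hn3
  have hnat : ∀ i < δ, (i : ZMod n) ∈ negTwoOrbits n δ := fun i hi => ⟨i, hi, 0, by simp⟩
  refine ⟨isHermitianLCD_cyclicCodeOf hβ hdvd hZ hF hneg, ?_, ?_⟩
  · intro c hc hc0
    rw [mem_cyclicCodeOf_iff hβ hdvd hZ] at hc
    have := bch_bound hβ hc0 (-((δ - 1) / 2 : ℕ)) (δ + (δ - 1) / 2) fun j hj => hc _ ?_
    · omega
    rcases le_or_gt ((δ - 1) / 2) j with h | h
    · rw [neg_add_eq_sub, ← Nat.cast_sub h]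
      exact hnat _ (by omega)
    · rw [neg_add_eq_sub, ← hneg, ← neg_sub, ← Nat.cast_sub h.le]
      convert hnat (2 * ((δ - 1) / 2 - j)) (by omega) using 1
      push_cast
      ring
  · have hle := natDegree_generator_le hdvd
    have hfin : (Module.finrank F (cyclicCodeOf n g) : ℤ) =
        n - ((negTwoOrbits n δ).ncard : ℤ) := by
      rw [finrank_cyclicCodeOf (generator_ne_zero hdvd) hle, Nat.cast_sub hle,
        natDegree_generator hβ hdvd hZ]
    rw [hfin]
    have ht4 : 2 ^ 3 ∣ 2 ^ m := pow_dvd_pow 2 (by omega)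
    have h1 : 2 ^ (m + 1) = 2 * 2 ^ m := by ring
    have h2 : 2 * 2 ^ (m - 1) = 2 ^ m := by
      rw [← pow_succ', Nat.sub_add_cancel (by omega)]
    obtain ⟨d, rfl⟩ : ∃ d, δ = d + 1 := ⟨δ - 1, by omega⟩
    have hcount := ncard_negTwoOrbits hm hodd hn3 d
    rw [Nat.add_sub_cancel]
    have key : ∀ e : ℕ, d + 2 ≤ 2 ^ m → exceptionalCount m (d + 1) = e →
        (n : ℤ) - ((negTwoOrbits n (d + 1)).ncard : ℤ) =
          n - 2 * (((d + 1 : ℕ) : ℤ) - (d / 4 : ℕ) - (e + 1)) * m - 1 := by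
      intro e hd he
      rw [hcount hd, he]
      push_cast
      ring
    refine ⟨fun h => ?_, fun h => ?_, fun h h' => ?_, fun h h' => ?_, fun h => ?_⟩
    · refine (key 0 (by omega) ?_).trans (by norm_num)
      unfold exceptionalCount
      split_ifs <;> omega
    · refine (key 1 (by omega) ?_).trans (by norm_num)
      unfold exceptionalCount
      split_ifs <;> omega
    · refine (key 2 (by omega) ?_).trans (by norm_num)
      unfold exceptionalCount
      split_ifs <;> omega
    · refine (key 3 (by omega) ?_).trans (by norm_num)
      unfold exceptionalCount
      split_ifs <;> omega
    · obtain ⟨d, rfl⟩ : ∃ d', d = d' + 1 := ⟨d - 1, by omega⟩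
      have he : exceptionalCount m (d + 1) = 3 := by
        unfold exceptionalCount
        split_ifs <;> omega
      have hq : (d + 1) / 4 = d / 4 := by omega
      rw [ncard_negTwoOrbits_two_pow hm hodd hn3 h, Nat.cast_add,
        ncard_negTwoOrbits hm hodd hn3 d (by omega), he, hq]
      push_cast
      ring
end
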